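/- arXiv:2402.06730 — 8 statements merged into one kernel-verified Lean document; each statement's English description precedes it below -/
import Mathlib

section
/- Let (M,dist) be a metric space, S ⊆ M a finite set, a ∈ M, δ ≥ 0 and γ > 1. Suppose c* ∈ M satisfies dist(a,c*) ≤ δ, that S contains at least one point of the closed ball of radius γδ around a, that c' ∈ S satisfies dist(c*,c') = min_{s∈S} dist(c*,s), and that c is a point of S lying in the closed ball of radius γδ around a that minimizes dist(c*,·) among all such points. Then dist(c*,c) ≤ ((γ+1)/(γ−1))·dist(c*,c'). -/
/-- In a metric space, if `c*` is within `δ` of the anchor point `a`,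
`c'` is the closest point of the finite set `S` to `c*`, and `c` is a point of `S`
inside the anchor zone (closed ball of radius `γδ` around `a`) minimizing the distance
to `c*` among the points of `S` in the anchor zone, then
`dist(c*,c) ≤ ((γ+1)/(γ−1))·dist(c*,c')`. -/
theorem stmt_2 {M : Type*} [MetricSpace M] (S : Finset M) (a cstar c' c : M)
    (δ γ : ℝ) (hδ : 0 ≤ δ) (hγ : 1 < γ)
    (hacstar : dist a cstar ≤ δ)
    (hball : ∃ s ∈ S, dist a s ≤ γ * δ)
    (hc'S : c' ∈ S) (hc'min : ∀ s ∈ S, dist cstar c' ≤ dist cstar s)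
    (hcS : c ∈ S) (hcball : dist a c ≤ γ * δ)
    (hcmin : ∀ s ∈ S, dist a s ≤ γ * δ → dist cstar c ≤ dist cstar s) :
    dist cstar c ≤ ((γ + 1) / (γ - 1)) * dist cstar c' := by
  have hγ' : 0 < γ - 1 := sub_pos.mpr hγ
  have hd' : 0 ≤ dist cstar c' := dist_nonneg
  rw [div_mul_eq_mul_div, le_div_iff₀ hγ']
  by_cases hc' : dist a c' ≤ γ * δ
  · have hle := mul_le_mul_of_nonneg_right (hcmin c' hc'S hc') hγ'.le
    linarith
  · have hfar : (γ - 1) * δ ≤ dist cstar c' := by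
      linarith [dist_triangle a cstar c']
    have hnear : dist cstar c ≤ (γ + 1) * δ := by
      linarith [dist_triangle_left cstar c a]
    calc dist cstar c * (γ - 1) ≤ (γ + 1) * δ * (γ - 1) := by gcongr
      _ = (γ + 1) * ((γ - 1) * δ) := by ring
      _ ≤ (γ + 1) * dist cstar c' := by gcongr
end

section
/- Let (M,dist) be a metric space, γ > 2, let A ⊆ M be a finite set with radii δ : A → ℝ≥0, and let k be a nonnegative integer. Suppose the instance is feasible, i.e., there exists T ⊆ A with |T| ≤ k such that dist(p,T) ≤ δ(p) for every p ∈ A. Let p₁, …, p_m ∈ A be distinct points such that δ(p₁) ≤ δ(p₂) ≤ … ≤ δ(p_m) and dist(p_i, p_j) > γ·δ(p_i) for all 1 ≤ j < i ≤ m. Then m ≤ k. -/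
/-- correctness of greedy seeding. Let `γ > 2`, let `A` be a finite
set of points with radii `δ ≥ 0`, and suppose some `T ⊆ A` with `|T| ≤ k` satisfies
`dist(p,T) ≤ δ(p)` for every `p ∈ A` (feasibility). If `p₁, …, p_m ∈ A` are distinct,
`δ(p₁) ≤ … ≤ δ(p_m)`, and `dist(p_i,p_j) > γ·δ(p_i)` whenever `j < i`, then `m ≤ k`. -/
theorem stmt_5 {M : Type*} [MetricSpace M] (γ : ℝ) (hγ : 2 < γ)
    (A : Finset M) (δ : M → ℝ) (hδ : ∀ a ∈ A, 0 ≤ δ a) (k : ℕ)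
    (hfeas : ∃ T : Finset M, T ⊆ A ∧ T.card ≤ k ∧ ∀ p ∈ A, ∃ t ∈ T, dist p t ≤ δ p)
    (m : ℕ) (p : Fin m → M) (hpA : ∀ i, p i ∈ A) (hinj : Function.Injective p)
    (hmono : ∀ i j : Fin m, i ≤ j → δ (p i) ≤ δ (p j))
    (hfar : ∀ i j : Fin m, j < i → γ * δ (p i) < dist (p i) (p j)) :
    m ≤ k := by
  obtain ⟨T, -, hTk, hT⟩ := hfeas
  choose f hfT hf using fun i => hT (p i) (hpA i)
  have hne : ∀ i j, j < i → f i ≠ f j := by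
    intro i j hji hij
    have hfi := hf i
    have hfj := hf j
    rw [← hij] at hfj
    have htri := dist_triangle_right (p i) (p j) (f i)
    have hγδ : 2 * δ (p i) ≤ γ * δ (p i) :=
      mul_le_mul_of_nonneg_right hγ.le (hδ _ (hpA i))
    linarith [hfar i j hji, hmono j i hji.le]
  have hfinj : Function.Injective f := by
    intro i j hij
    rcases lt_trichotomy i j with h | h | h
    · exact absurd hij.symm (hne j i h)
    · exact h
    · exact absurd hij (hne i j h)
  calc m = (Finset.univ : Finset (Fin m)).card := by simp
    _ ≤ T.card := Finset.card_le_card_of_injOn f (fun i _ => hfT i) hfinj.injOn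
    _ ≤ k := hTk
end

section
/- Let Q ⊆ ℝ^d be a finite nonempty point set, let S ⊆ ℝ^d be a finite nonempty set of centers, and let α ≥ 9. If cost(Q,S) ≥ α·cost(Q,{μ(Q)}), then cost(R,S) ≥ ((α−1)/8)·cost(Q,{μ(Q)}), where R = {q ∈ Q : ‖q − μ(Q)‖² ≤ (2/|Q|)·cost(Q,{μ(Q)})} is the subset of Q at squared distance at most (2/|Q|)·cost(Q,{μ(Q)}) from μ(Q). -/
/-- The sum of squared distances to a point `s` splits into the sum of squared distances to the
centroid plus the squared distance between `s` and the centroid, counted once per point. -/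
theorem sum_norm_sub_sq_eq_centroid {E : Type*} [NormedAddCommGroup E] [InnerProductSpace ℝ E]
    (Q : Finset E) (hQ : Q.Nonempty) (s : E) :
    ∑ q ∈ Q, ‖q - s‖ ^ 2
      = ∑ q ∈ Q, ‖q - (Q.card : ℝ)⁻¹ • ∑ x ∈ Q, x‖ ^ 2
        + Q.card * ‖(Q.card : ℝ)⁻¹ • ∑ x ∈ Q, x - s‖ ^ 2 := by
  have hn : (Q.card : ℝ) ≠ 0 := by exact_mod_cast hQ.card_pos.ne'
  set m := (Q.card : ℝ)⁻¹ • ∑ x ∈ Q, x with hm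
  have hzero : ∑ q ∈ Q, (q - m) = 0 := by
    rw [Finset.sum_sub_distrib, Finset.sum_const, ← Nat.cast_smul_eq_nsmul ℝ, hm, smul_smul,
      mul_inv_cancel₀ hn, one_smul, sub_self]
  have hsplit : ∀ q ∈ Q, ‖q - s‖ ^ 2
      = ‖q - m‖ ^ 2 + 2 * inner ℝ (q - m) (m - s) + ‖m - s‖ ^ 2 := fun q _ => by
    rw [← norm_add_sq_real, sub_add_sub_cancel]
  rw [Finset.sum_congr rfl hsplit, Finset.sum_add_distrib, Finset.sum_add_distrib,
    ← Finset.mul_sum, ← sum_inner, hzero, inner_zero_left, Finset.sum_const, nsmul_eq_mul]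
  ring

/-- Markov's inequality for finite sums: at least half of the values of a nonnegative function are
at most twice its average. -/
theorem card_le_two_mul_card_filter_le_average {ι : Type*} (Q : Finset ι) (f : ι → ℝ)
    (hf : ∀ q ∈ Q, 0 ≤ f q) {V : ℝ} (hV : V = ∑ q ∈ Q, f q) (hpos : 0 < V)
    [DecidablePred fun q => f q ≤ 2 / (Q.card : ℝ) * V] :
    (Q.card : ℝ) ≤ 2 * ((Q.filter fun q => f q ≤ 2 / (Q.card : ℝ) * V).card : ℝ) := by
  have hn : (0 : ℝ) < Q.card := by
    exact_mod_cast (Finset.nonempty_of_sum_ne_zero (hV ▸ hpos).ne').card_pos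
  have hcard := Finset.card_filter_add_card_filter_not (s := Q)
    (fun q => f q ≤ 2 / (Q.card : ℝ) * V)
  set B := Q.filter fun q => ¬ f q ≤ 2 / (Q.card : ℝ) * V
  have hfar : (B.card : ℝ) * (2 / (Q.card : ℝ) * V) ≤ V := by
    rw [← nsmul_eq_mul]
    refine (Finset.card_nsmul_le_sum B f _ fun q hq => ?_).trans
      (hV ▸ Finset.sum_le_sum_of_subset_of_nonneg (Finset.filter_subset _ _) fun q hq _ => hf q hq)
    exact (not_le.1 (Finset.mem_filter.1 hq).2).le
  have hhalf : 2 * (B.card : ℝ) ≤ Q.card := by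
    rw [div_mul_eq_mul_div, mul_div_assoc', div_le_iff₀ hn] at hfar
    nlinarith
  have hcard' := congrArg (Nat.cast : ℕ → ℝ) hcard
  push_cast at hcard'
  linarith


/- **Statement 6** (Lemma 6 of Lattanzi–Sohler, restated). If `cost(Q,S) ≥ α·cost(Q,{μ(Q)})`
with `α ≥ 9`, then the points `R ⊆ Q` at squared distance at most `(2/|Q|)·cost(Q,{μ(Q)})`
from the centroid satisfy `cost(R,S) ≥ ((α−1)/8)·cost(Q,{μ(Q)})`. -/
open scoped Classical in
theorem stmt_6 {d : ℕ} (Q S : Finset (EuclideanSpace ℝ (Fin d)))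
    (hQ : Q.Nonempty) (hS : S.Nonempty) (α : ℝ) (hα : 9 ≤ α)
    (hcost : ∑ q ∈ Q, S.inf' hS (fun s => ‖q - s‖ ^ 2)
        ≥ α * ∑ q ∈ Q, ‖q - (Q.card : ℝ)⁻¹ • ∑ x ∈ Q, x‖ ^ 2) :
    ∑ q ∈ Q.filter (fun q =>
        ‖q - (Q.card : ℝ)⁻¹ • ∑ x ∈ Q, x‖ ^ 2
          ≤ (2 / (Q.card : ℝ)) * ∑ x ∈ Q, ‖x - (Q.card : ℝ)⁻¹ • ∑ y ∈ Q, y‖ ^ 2),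
      S.inf' hS (fun s => ‖q - s‖ ^ 2)
      ≥ ((α - 1) / 8) * ∑ q ∈ Q, ‖q - (Q.card : ℝ)⁻¹ • ∑ x ∈ Q, x‖ ^ 2 := by
  have hn : (0 : ℝ) < Q.card := by exact_mod_cast hQ.card_pos
  set m := (Q.card : ℝ)⁻¹ • ∑ x ∈ Q, x with hm
  set V := ∑ q ∈ Q, ‖q - m‖ ^ 2 with hV
  have hdist_nonneg : ∀ q, 0 ≤ S.inf' hS (fun s => ‖q - s‖ ^ 2) := fun q =>
    Finset.le_inf' _ _ fun s _ => by positivity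
  have hV0 : 0 ≤ V := Finset.sum_nonneg fun q _ => by positivity
  rcases hV0.eq_or_lt with hzero | hpos
  · rw [← hzero, mul_zero, mul_zero, ge_iff_le]
    exact Finset.sum_nonneg fun q _ => hdist_nonneg q
  have hfar : ∀ s ∈ S, (α - 1) * V ≤ Q.card * ‖m - s‖ ^ 2 := fun s hs => by
    have hle : ∑ q ∈ Q, S.inf' hS (fun s => ‖q - s‖ ^ 2) ≤ ∑ q ∈ Q, ‖q - s‖ ^ 2 :=
      Finset.sum_le_sum fun q _ => Finset.inf'_le _ hs
    rw [sum_norm_sub_sq_eq_centroid Q hQ s, ← hm, ← hV] at hle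
    linarith
  have hmarkov := card_le_two_mul_card_filter_le_average Q (fun q => ‖q - m‖ ^ 2)
    (fun q _ => by positivity) hV hpos
  set R := Q.filter fun q => ‖q - m‖ ^ 2 ≤ 2 / (Q.card : ℝ) * V
  have hpoint : ∀ q ∈ R, (α - 1) * V / (4 * Q.card) ≤ S.inf' hS (fun s => ‖q - s‖ ^ 2) := by
    intro q hq
    refine Finset.le_inf' _ _ fun s hs => ?_
    have hnear : Q.card * ‖q - m‖ ^ 2 ≤ 2 * V := by
      have h := (Finset.mem_filter.1 hq).2
      rw [div_mul_eq_mul_div, le_div_iff₀ hn] at h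
      linarith
    have hs' := hfar s hs
    have hdouble : 2 * ‖q - m‖ ≤ ‖m - s‖ := by
      refine (sq_le_sq₀ (by positivity) (norm_nonneg _)).1 ?_
      refine le_of_mul_le_mul_left ?_ hn
      nlinarith
    have htri : ‖m - s‖ ≤ ‖q - m‖ + ‖q - s‖ := by
      rw [norm_sub_rev q m]
      exact norm_sub_le_norm_sub_add_norm_sub m q s
    have hsq : ‖m - s‖ ^ 2 ≤ 4 * ‖q - s‖ ^ 2 := by
      nlinarith [norm_nonneg (m - s), norm_nonneg (q - s)]
    rw [div_le_iff₀ (by positivity)]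
    nlinarith [mul_le_mul_of_nonneg_left hsq hn.le]
  have hsum := Finset.card_nsmul_le_sum R _ _ hpoint
  rw [nsmul_eq_mul] at hsum
  refine ge_iff_le.2 (le_trans ?_ hsum)
  have hnum : 0 ≤ (α - 1) * V := mul_nonneg (by linarith) hV0
  rw [mul_div_assoc', le_div_iff₀ (by positivity)]
  nlinarith [mul_le_mul_of_nonneg_right hmarkov hnum]
end

section
/- Let f : O → C be a function between finite sets with |O| = |C|. Let H be the set of elements of C with exactly one preimage under f, let L be the set of elements of C with no preimage, and let R = {o ∈ O : f(o) has at least two preimages under f}. Then |R| ≤ 2·|L|. -/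
/-- counting fact for the capture map. Let `f : O → C` with
`|O| = |C|`, let `L ⊆ C` be the elements with no preimage, and let
`R = {o ∈ O : f(o) has at least two preimages}`. Then `|R| ≤ 2·|L|`. -/
theorem stmt_10 {O C : Type*} [Fintype O] [Fintype C] [DecidableEq C]
    (f : O → C) (hcard : Fintype.card O = Fintype.card C) :
    (Finset.univ.filter (fun o : O =>
        2 ≤ (Finset.univ.filter (fun o' : O => f o' = f o)).card)).card
      ≤ 2 * (Finset.univ.filter (fun c : C => ∀ o : O, f o ≠ c)).card := by
  have key : ∀ c : C,
      ((Finset.univ.filter (fun o : O =>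
          2 ≤ (Finset.univ.filter (fun o' : O => f o' = f o)).card)).filter
            (fun o => f o = c)).card + 2
        ≤ 2 * (Finset.univ.filter (fun o : O => f o = c)).card
          + 2 * (if ∀ o : O, f o ≠ c then 1 else 0) := by
    intro c
    by_cases h : 2 ≤ (Finset.univ.filter (fun o : O => f o = c)).card
    · have hle := Finset.card_le_card (Finset.filter_subset_filter (fun o => f o = c)
        (Finset.subset_univ (Finset.univ.filter (fun o : O =>
          2 ≤ (Finset.univ.filter (fun o' : O => f o' = f o)).card))))
      omega
    · have hR : (Finset.univ.filter (fun o : O =>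
          2 ≤ (Finset.univ.filter (fun o' : O => f o' = f o)).card)).filter
            (fun o => f o = c) = ∅ := by
        refine Finset.filter_eq_empty_iff.2 fun o ho hoc => h ?_
        subst hoc
        exact (Finset.mem_filter.1 ho).2
      rw [hR, Finset.card_empty]
      split_ifs with hL
      · omega
      · push Not at hL
        obtain ⟨o, ho⟩ := hL
        have hpos : 0 < (Finset.univ.filter (fun o : O => f o = c)).card :=
          Finset.card_pos.2 ⟨o, by simp [ho]⟩
        omega
  have hsum := Finset.sum_le_sum fun c (_ : c ∈ (Finset.univ : Finset C)) => key c
  rw [Finset.sum_add_distrib, Finset.sum_add_distrib, ← Finset.mul_sum, ← Finset.mul_sum,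
    ← Finset.card_eq_sum_card_fiberwise fun _ _ => Finset.mem_coe.2 (Finset.mem_univ _),
    ← Finset.card_eq_sum_card_fiberwise fun _ _ => Finset.mem_coe.2 (Finset.mem_univ _),
    ← Finset.card_filter, Finset.sum_const, Finset.card_univ, Finset.card_univ, hcard,
    smul_eq_mul] at hsum
  omega
end

section
/- Let X ⊆ ℝ^d be a finite set, S ⊆ ℝ^d a finite set of centers with |S| ≥ 2, c_h ∈ S, P ⊆ X, and c ∈ ℝ^d. Then cost(X, (S∖{c_h})∪{c}) ≤ cost(X,S) − cost(P,S) + (cost(X∖P, S∖{c_h}) − cost(X∖P, S)) + cost(P,{c}). -/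
/-- `kcost Q S = ∑_{q∈Q} min_{s∈S} dist(q,s)²`: the k-means cost of the finite point
set `Q` with respect to the (nonempty) set of centers `S`. -/
noncomputable def kcost {d : ℕ} (Q : Finset (EuclideanSpace ℝ (Fin d)))
    (S : Set (EuclideanSpace ℝ (Fin d))) : ℝ :=
  ∑ q ∈ Q, sInf ((fun s => dist q s ^ 2) '' S)

theorem kcost_anti_right {d : ℕ} (Q : Finset (EuclideanSpace ℝ (Fin d)))
    {S T : Set (EuclideanSpace ℝ (Fin d))} (hS : S.Nonempty) (hST : S ⊆ T) :
    kcost Q T ≤ kcost Q S := by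
  refine Finset.sum_le_sum fun q _ => csInf_le_csInf ⟨0, ?_⟩ (hS.image _) (Set.image_mono hST)
  rintro _ ⟨s, _, rfl⟩
  positivity

open scoped Classical in
theorem kcost_sdiff_add_kcost {d : ℕ} {P X : Finset (EuclideanSpace ℝ (Fin d))} (hP : P ⊆ X)
    (S : Set (EuclideanSpace ℝ (Fin d))) :
    kcost (X \ P) S + kcost P S = kcost X S :=
  Finset.sum_sdiff hP

/- **Statement 11** (swap cost bound). For finite `X`, centers `S` with `|S| ≥ 2`,
`c_h ∈ S`, `P ⊆ X` and a new center `c`,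
`cost(X,(S∖{c_h})∪{c}) ≤ cost(X,S) − cost(P,S)
   + (cost(X∖P,S∖{c_h}) − cost(X∖P,S)) + cost(P,{c})`. -/
open scoped Classical in
theorem stmt_11 {d : ℕ} (X S : Finset (EuclideanSpace ℝ (Fin d)))
    (hS : 2 ≤ S.card) (ch : EuclideanSpace ℝ (Fin d)) (hch : ch ∈ S)
    (P : Finset (EuclideanSpace ℝ (Fin d))) (hP : P ⊆ X)
    (c : EuclideanSpace ℝ (Fin d)) :
    kcost X ((↑S \ {ch}) ∪ {c})
      ≤ kcost X ↑S - kcost P ↑S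
        + (kcost (X \ P) (↑S \ {ch}) - kcost (X \ P) ↑S)
        + kcost P {c} := by
  obtain ⟨s, hs, hne⟩ := Finset.exists_mem_ne hS ch
  have hkept : kcost (X \ P) ((↑S \ {ch}) ∪ {c}) ≤ kcost (X \ P) (↑S \ {ch}) :=
    kcost_anti_right _ ⟨s, hs, hne⟩ Set.subset_union_left
  have hmoved : kcost P ((↑S \ {ch}) ∪ {c}) ≤ kcost P {c} :=
    kcost_anti_right _ (Set.singleton_nonempty c) Set.subset_union_right
  linarith [kcost_sdiff_add_kcost hP ((↑S \ {ch}) ∪ {c}), kcost_sdiff_add_kcost hP (S : Set _)]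
end

section
/- Let Q ⊆ ℝ^d be a finite nonempty set, S ⊆ ℝ^d a finite nonempty set of centers, a ∈ ℝ^d and δ ≥ 0. Suppose ‖a − μ(Q)‖ ≤ δ, that there exists s ∈ S with ‖a − s‖ ≤ 3δ, that cost(Q,S) > 9·cost(Q,{μ(Q)}), and that c ∈ ℝ^d satisfies ‖c − μ(Q)‖² ≤ (2/|Q|)·cost(Q,{μ(Q)}). Then ‖a − c‖ ≤ 3δ. -/
/-- Parallel axis identity: the cost of a center exceeds the cost of the mean by the squared
distance between the two, counted once per point. -/
theorem sum_norm_sub_sq_eq_add_card_mul {E : Type*} [NormedAddCommGroup E]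
    [InnerProductSpace ℝ E] (Q : Finset E) (hQ : Q.Nonempty) (s : E) :
    ∑ q ∈ Q, ‖q - s‖ ^ 2 = ∑ q ∈ Q, ‖q - (Q.card : ℝ)⁻¹ • ∑ y ∈ Q, y‖ ^ 2
      + Q.card * ‖s - (Q.card : ℝ)⁻¹ • ∑ y ∈ Q, y‖ ^ 2 := by
  have hn : (Q.card : ℝ) ≠ 0 := by exact_mod_cast hQ.card_pos.ne'
  set m : E := (Q.card : ℝ)⁻¹ • ∑ y ∈ Q, y with hm
  have hzero : ∑ q ∈ Q, (q - m) = 0 := by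
    rw [Finset.sum_sub_distrib, Finset.sum_const, ← Nat.cast_smul_eq_nsmul ℝ, hm,
      smul_inv_smul₀ hn, sub_self]
  have hcross : ∑ q ∈ Q, inner ℝ (q - m) (s - m) = 0 := by
    rw [← sum_inner, hzero, inner_zero_left]
  have hterm (q : E) :
      ‖q - s‖ ^ 2 = ‖q - m‖ ^ 2 - 2 * inner ℝ (q - m) (s - m) + ‖s - m‖ ^ 2 := by
    rw [← norm_sub_sq_real, sub_sub_sub_cancel_right]
  simp only [hterm, Finset.sum_add_distrib, Finset.sum_sub_distrib, ← Finset.mul_sum, hcross,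
    Finset.sum_const, nsmul_eq_mul, mul_zero, sub_zero]

/- **Statement 13** (feasibility of the swap, γ = 3). Let `Q, S ⊆ ℝ^d` be finite and
nonempty, `a ∈ ℝ^d`, `δ ≥ 0`. If `‖a − μ(Q)‖ ≤ δ`, some `s ∈ S` has `‖a − s‖ ≤ 3δ`,
`cost(Q,S) > 9·cost(Q,{μ(Q)})`, and `‖c − μ(Q)‖² ≤ (2/|Q|)·cost(Q,{μ(Q)})`, then
`‖a − c‖ ≤ 3δ`, i.e. the sampled point `c` lies in the anchor zone of `a`. -/
theorem stmt_13 {d : ℕ} (Q S : Finset (EuclideanSpace ℝ (Fin d)))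
    (hQ : Q.Nonempty) (hS : S.Nonempty)
    (a c : EuclideanSpace ℝ (Fin d)) (δ : ℝ) (hδ : 0 ≤ δ)
    (ha : ‖a - (Q.card : ℝ)⁻¹ • ∑ x ∈ Q, x‖ ≤ δ)
    (hs : ∃ s ∈ S, ‖a - s‖ ≤ 3 * δ)
    (hcost : ∑ q ∈ Q, S.inf' hS (fun s => ‖q - s‖ ^ 2)
        > 9 * ∑ q ∈ Q, ‖q - (Q.card : ℝ)⁻¹ • ∑ y ∈ Q, y‖ ^ 2)
    (hc : ‖c - (Q.card : ℝ)⁻¹ • ∑ x ∈ Q, x‖ ^ 2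
        ≤ (2 / (Q.card : ℝ)) * ∑ x ∈ Q, ‖x - (Q.card : ℝ)⁻¹ • ∑ y ∈ Q, y‖ ^ 2) :
    ‖a - c‖ ≤ 3 * δ := by
  obtain ⟨s, hsS, has⟩ := hs
  have hn : (0 : ℝ) < Q.card := by exact_mod_cast hQ.card_pos
  have hle : ∑ q ∈ Q, S.inf' hS (fun s => ‖q - s‖ ^ 2) ≤ ∑ q ∈ Q, ‖q - s‖ ^ 2 :=
    Finset.sum_le_sum fun q _ => Finset.inf'_le _ hsS
  rw [sum_norm_sub_sq_eq_add_card_mul Q hQ s] at hle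
  set m := (Q.card : ℝ)⁻¹ • ∑ x ∈ Q, x
  set V := ∑ q ∈ Q, ‖q - m‖ ^ 2
  have hsm : ‖s - m‖ ≤ 4 * δ := by
    have h := norm_sub_le_norm_sub_add_norm_sub s a m
    rw [norm_sub_rev s a] at h
    linarith
  have hsm_sq : (Q.card : ℝ) * ‖s - m‖ ^ 2 ≤ Q.card * (4 * δ) ^ 2 := by gcongr
  have hV : 2 / (Q.card : ℝ) * V ≤ (2 * δ) ^ 2 := by
    rw [div_mul_eq_mul_div, div_le_iff₀ hn]
    linarith
  have hcm : ‖c - m‖ ≤ 2 * δ := abs_le_of_sq_le_sq' (hc.trans hV) (by positivity) |>.2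
  have h := norm_sub_le_norm_sub_add_norm_sub a m c
  rw [norm_sub_rev m c] at h
  linarith
end

section
/- Let (M,dist) be a metric space, A a finite nonempty set of points of M, S a finite nonempty set of points of M, and let π : S → M be a map with π(s) ∈ A and dist(s,π(s)) = min_{a∈A} dist(s,a) for every s ∈ S (π(s) is a closest point of A to s). Let S' = π(S) = {π(s) : s ∈ S}. Then ∑_{a∈A} dist(a,S')² ≤ 4·∑_{a∈A} dist(a,S)². -/
/- **Statement 15**. Replacing every center of a solution `S` by a closest data
point of `A` (the map `π`) increases the k-means cost by at most a factor 4: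
`∑_{a∈A} dist(a,π(S))² ≤ 4·∑_{a∈A} dist(a,S)²`. -/
open scoped Classical in
theorem stmt_15 {M : Type*} [MetricSpace M] (A S : Finset M)
    (hA : A.Nonempty) (hS : S.Nonempty) (π : M → M)
    (hπA : ∀ s ∈ S, π s ∈ A)
    (hπmin : ∀ s ∈ S, ∀ a ∈ A, dist s (π s) ≤ dist s a) :
    ∑ a ∈ A, (S.image π).inf' (hS.image π) (fun s' => dist a s') ^ 2
      ≤ 4 * ∑ a ∈ A, S.inf' hS (fun s => dist a s) ^ 2 := by
  rw [Finset.mul_sum]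
  refine Finset.sum_le_sum fun a ha => ?_
  obtain ⟨s, hs, hs_eq⟩ := Finset.exists_mem_eq_inf' hS (fun s => dist a s)
  have h_nonneg : 0 ≤ (S.image π).inf' (hS.image π) (fun s' => dist a s') :=
    Finset.le_inf' _ _ fun _ _ => dist_nonneg
  have h_le : (S.image π).inf' (hS.image π) (fun s' => dist a s') ≤ 2 * dist a s :=
    calc (S.image π).inf' (hS.image π) (fun s' => dist a s')
        ≤ dist a (π s) := Finset.inf'_le _ (Finset.mem_image_of_mem π hs)
      _ ≤ dist a s + dist s (π s) := dist_triangle _ _ _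
      _ ≤ dist a s + dist s a := by gcongr; exact hπmin s hs a ha
      _ = 2 * dist a s := by rw [dist_comm s a]; ring
  rw [hs_eq]
  calc (S.image π).inf' (hS.image π) (fun s' => dist a s') ^ 2
      ≤ (2 * dist a s) ^ 2 := by gcongr
    _ = 4 * dist a s ^ 2 := by ring
end

section
/- Let (M,dist) be a metric space, S a finite nonempty set of points of M (a cluster), c' ∈ M (its current center), C a finite nonempty set of points of M (the allowed centers), and u ∈ C with dist(c',u) ≤ dist(c',v) for all v ∈ C. Then for every map f : S → C, ∑_{s∈S} dist(s,u) ≤ ∑_{s∈S} (2·dist(s,c') + dist(s,f(s))). -/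
/-- per-cluster center replacement. In a metric space, let `S` be a
cluster with current center `c'`, let `C` be the allowed centers and `u ∈ C` a closest
point of `C` to `c'`. Then for every assignment `f : S → C`,
`∑_{s∈S} dist(s,u) ≤ ∑_{s∈S} (2·dist(s,c') + dist(s,f(s)))`. -/
theorem stmt_16 {M : Type*} [MetricSpace M] (S C : Finset M)
    (hS : S.Nonempty) (hC : C.Nonempty) (c' : M)
    (u : M) (hu : u ∈ C) (humin : ∀ v ∈ C, dist c' u ≤ dist c' v)
    (f : M → M) (hf : ∀ s ∈ S, f s ∈ C) :
    ∑ s ∈ S, dist s u ≤ ∑ s ∈ S, (2 * dist s c' + dist s (f s)) := by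
  refine Finset.sum_le_sum fun s hs => ?_
  calc dist s u ≤ dist s c' + dist c' u := dist_triangle s c' u
    _ ≤ dist s c' + dist c' (f s) := by gcongr; exact humin _ (hf s hs)
    _ ≤ dist s c' + (dist c' s + dist s (f s)) := by gcongr; exact dist_triangle c' s (f s)
    _ = 2 * dist s c' + dist s (f s) := by rw [dist_comm c' s]; ring
end
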